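/- arXiv:2403.09446 — 2 statements merged into one kernel-verified Lean document; each statement's English description precedes it below -/
import Mathlib

section
/- Let Λ be a lattice of full rank 3 in a 3-dimensional Euclidean space whose set S(Λ) of minimal vectors supports an equiangular family of lines, i.e. there is a constant c with |⟨x, y⟩| = c for all non-proportional x, y ∈ S(Λ). Then s(Λ) ≤ 4; that is, the minimal vectors of a 3-dimensional lattice define at most 4 equiangular lines. -/
open scoped InnerProductSpace

/-- The Gram determinant of four linearly dependent vectors of norm `m`, the first of which has
inner product `c` with the three others. -/
theorem gram_det_eq_zero_of_finrank_eq_three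
    {E : Type*} [NormedAddCommGroup E] [InnerProductSpace ℝ E] [FiniteDimensional ℝ E]
    (hdim : Module.finrank ℝ E = 3) {m c p q r : ℝ} {x y z w : E}
    (hx : ⟪x, x⟫_ℝ = m) (hy : ⟪y, y⟫_ℝ = m) (hz : ⟪z, z⟫_ℝ = m) (hw : ⟪w, w⟫_ℝ = m)
    (hxy : ⟪x, y⟫_ℝ = c) (hxz : ⟪x, z⟫_ℝ = c) (hxw : ⟪x, w⟫_ℝ = c)
    (hyz : ⟪y, z⟫_ℝ = p) (hyw : ⟪y, w⟫_ℝ = q) (hzw : ⟪z, w⟫_ℝ = r) :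
    (!![m, c, c, c; c, m, p, q; c, p, m, r; c, q, r, m] : Matrix (Fin 4) (Fin 4) ℝ).det = 0 := by
  have hdep : ¬ LinearIndependent ℝ ![x, y, z, w] := fun h => by
    have := h.fintype_card_le_finrank
    simp [hdim] at this
  obtain ⟨g, hg, hg0⟩ := Fintype.not_linearIndependent_iff.mp hdep
  refine Matrix.exists_mulVec_eq_zero_iff.mp ⟨g, fun h => ?_, ?_⟩
  · obtain ⟨i, hi⟩ := hg0
    exact hi (congrFun h i)
  · have key (v : E) : g 0 * ⟪v, x⟫_ℝ + g 1 * ⟪v, y⟫_ℝ + g 2 * ⟪v, z⟫_ℝ + g 3 * ⟪v, w⟫_ℝ = 0 := by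
      have := congrArg (fun u => ⟪v, u⟫_ℝ) hg
      simpa [Fin.sum_univ_four, inner_add_right, real_inner_smul_right] using this
    have h1 := key x
    have h2 := key y
    have h3 := key z
    have h4 := key w
    rw [hx, hxy, hxz, hxw] at h1
    rw [real_inner_comm, hxy, hy, hyz, hyw] at h2
    rw [real_inner_comm, hxz, real_inner_comm, hyz, hz, hzw] at h3
    rw [real_inner_comm, hxw, real_inner_comm, hyw, real_inner_comm, hzw, hw] at h4
    funext i
    fin_cases i <;> simp [Matrix.mulVec, dotProduct, Fin.sum_univ_four] <;> linarith

theorem gram_det_eq (m c p q r : ℝ) :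
    (!![m, c, c, c; c, m, p, q; c, p, m, r; c, q, r, m] : Matrix (Fin 4) (Fin 4) ℝ).det =
      m ^ 4 - m ^ 2 * (3 * c ^ 2 + p ^ 2 + q ^ 2 + r ^ 2)
        + 2 * m * (c ^ 2 * (p + q + r) + p * q * r)
        + c ^ 2 * (p ^ 2 + q ^ 2 + r ^ 2 - 2 * p * q - 2 * p * r - 2 * q * r) := by
  simp [Matrix.det_succ_row_zero, Fin.sum_univ_succ, Fin.succAbove]
  ring

/-- In a `3`-dimensional lattice whose minimal vectors are equiangular, three pairwise
non-proportional minimal vectors having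
the same inner product with a fourth one sum to it. -/
theorem eq_sub_sub_of_equiangular
    {E : Type*} [NormedAddCommGroup E] [InnerProductSpace ℝ E] [FiniteDimensional ℝ E]
    (hdim : Module.finrank ℝ E = 3) {Λ : AddSubgroup E} {m c : ℝ} (hm : 0 < m)
    (hmin : ∀ v ∈ Λ, v ≠ 0 → m ≤ ⟪v, v⟫_ℝ)
    {x y z w : E} (hxΛ : x ∈ Λ) (hyΛ : y ∈ Λ) (hzΛ : z ∈ Λ) (hwΛ : w ∈ Λ)
    (hx : ⟪x, x⟫_ℝ = m) (hy : ⟪y, y⟫_ℝ = m) (hz : ⟪z, z⟫_ℝ = m) (hw : ⟪w, w⟫_ℝ = m)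
    (hne : x ≠ y)
    (hxy : ⟪x, y⟫_ℝ = c) (hxz : ⟪x, z⟫_ℝ = c) (hxw : ⟪x, w⟫_ℝ = c)
    (hyz : |⟪y, z⟫_ℝ| = c) (hyw : |⟪y, w⟫_ℝ| = c) (hzw : |⟪z, w⟫_ℝ| = c) :
    w = x - y - z := by
  have hc : 0 ≤ c := hyz ▸ abs_nonneg _
  have hmc : 2 * c ≤ m := by
    have := hmin (x - y) (Λ.sub_mem hxΛ hyΛ) (sub_ne_zero.mpr hne)
    rw [real_inner_sub_sub_self, hx, hy, hxy] at this
    linarith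
  have triple {u v t : E} (hu : u ∈ Λ) (hv : v ∈ Λ) (huu : ⟪u, u⟫_ℝ = m) (hvv : ⟪v, v⟫_ℝ = m)
      (hxu : ⟪x, u⟫_ℝ = c) (hxv : ⟪x, v⟫_ℝ = c) (huv : ⟪u, v⟫_ℝ = -c)
      (hxt : ⟪x, t⟫_ℝ = c) (hut : |⟪u, t⟫_ℝ| = c) (hvt : |⟪v, t⟫_ℝ| = c) : 3 * c ≤ m := by
    have hnorm : ⟪x - u - v, x - u - v⟫_ℝ = 3 * m - 6 * c := by
      rw [real_inner_sub_sub_self, real_inner_sub_sub_self, inner_sub_left, hx, huu, hvv, hxu, hxv,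
        huv]
      ring
    by_cases h0 : x - u - v = 0
    · have ht : ⟪x - u - v, t⟫_ℝ = 0 := by rw [h0, inner_zero_left]
      rw [inner_sub_left, inner_sub_left, hxt] at ht
      rcases eq_or_eq_neg_of_abs_eq hut with h1 | h1 <;>
        rcases eq_or_eq_neg_of_abs_eq hvt with h2 | h2 <;> rw [h1, h2] at ht <;> linarith
    · have := hmin _ (Λ.sub_mem (Λ.sub_mem hxΛ hu) hv) h0
      linarith
  have hyz' : ⟪y, z⟫_ℝ = -c → 3 * c ≤ m := fun h =>
    triple hyΛ hzΛ hy hz hxy hxz h hxw hyw hzw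
  have hyw' : ⟪y, w⟫_ℝ = -c → 3 * c ≤ m := fun h =>
    triple hyΛ hwΛ hy hw hxy hxw h hxz hyz (real_inner_comm w z ▸ hzw)
  have hzw' : ⟪z, w⟫_ℝ = -c → 3 * c ≤ m := fun h =>
    triple hzΛ hwΛ hz hw hxz hxw h hxy (real_inner_comm z y ▸ hyz) (real_inner_comm w y ▸ hyw)
  have hdet := gram_det_eq_zero_of_finrank_eq_three hdim hx hy hz hw hxy hxz hxw rfl rfl rfl
  rw [gram_det_eq] at hdet
  have h1 : 0 < m - c := by linarith
  have h2 : 0 < m + c := by linarith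
  have h3 : 0 < m + 3 * c := by linarith
  have mixed (h : 3 * c ≤ m) : (m ^ 2 - 5 * c ^ 2) * ((m - c) * (m + c)) ≠ 0 := by
    have : 0 < m ^ 2 - 5 * c ^ 2 := by nlinarith
    positivity
  rcases eq_or_eq_neg_of_abs_eq hyz with p | p <;>
    rcases eq_or_eq_neg_of_abs_eq hyw with q | q <;>
    rcases eq_or_eq_neg_of_abs_eq hzw with r | r <;> rw [p, q, r] at hdet
  · have : (m - c) ^ 3 * (m + 3 * c) ≠ 0 := by positivity
    exact absurd (by linear_combination hdet) this
  · exact absurd (by linear_combination hdet) (mixed (hzw' r))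
  · exact absurd (by linear_combination hdet) (mixed (hyw' q))
  · exact absurd (by linear_combination hdet) (mixed (hyw' q))
  · exact absurd (by linear_combination hdet) (mixed (hyz' p))
  · exact absurd (by linear_combination hdet) (mixed (hyz' p))
  · exact absurd (by linear_combination hdet) (mixed (hyz' p))
  · have h4 : (m - 3 * c) * (m + c) ^ 3 = 0 := by linear_combination hdet
    have h5 : m - 3 * c = 0 := (mul_eq_zero.mp h4).resolve_right (by positivity)
    have h6 : ⟪x - y - z - w, x - y - z - w⟫_ℝ = 0 := by
      rw [real_inner_sub_sub_self, real_inner_sub_sub_self, real_inner_sub_sub_self]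
      simp only [inner_sub_left, hx, hy, hz, hw, hxy, hxz, hxw, p, q, r]
      linarith
    exact (sub_eq_zero.mp (inner_self_eq_zero.mp h6)).symm

/-- Proposition 2.3 (2). Let `Λ` be a lattice of full rank `3` in a
`3`-dimensional Euclidean space whose minimal vectors support an equiangular family of
lines. Then `s(Λ) ≤ 4`, i.e. the minimal vectors define at most `4` equiangular
lines (`|S(Λ)| ≤ 8`). -/
theorem dim_three_lattice_equiangular_bound
    {E : Type*} [NormedAddCommGroup E] [InnerProductSpace ℝ E] [FiniteDimensional ℝ E]
    (hdim : Module.finrank ℝ E = 3)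
    (Λ : AddSubgroup E) (hdisc : DiscreteTopology Λ)
    (hfull : Submodule.span ℝ (Λ : Set E) = ⊤)
    (m : ℝ)
    (hmin : IsLeast {r : ℝ | ∃ x ∈ Λ, x ≠ 0 ∧ ⟪x, x⟫_ℝ = r} m)
    (hequi : ∃ c : ℝ, ∀ x ∈ Λ, ∀ y ∈ Λ, ⟪x, x⟫_ℝ = m → ⟪y, y⟫_ℝ = m →
      y ≠ x → y ≠ -x → |⟪x, y⟫_ℝ| = c) :
    Nat.card {x : E | x ∈ Λ ∧ ⟪x, x⟫_ℝ = m} ≤ 8 := by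
  classical
  obtain ⟨⟨x₀, hx₀Λ, hx₀, hx₀m⟩, hlow⟩ := hmin
  have hm : 0 < m := hx₀m ▸ real_inner_self_pos.mpr hx₀
  have hmin' : ∀ v ∈ Λ, v ≠ 0 → m ≤ ⟪v, v⟫_ℝ := fun v hv h => hlow ⟨v, hv, h, rfl⟩
  obtain ⟨c, hc⟩ := hequi
  set S : Set E := {x : E | x ∈ Λ ∧ ⟪x, x⟫_ℝ = m}
  by_contra! hcard
  have pick (F : Finset E) (hF : F.card ≤ 8) : ∃ v ∈ S, v ∉ F := by
    obtain ⟨v, hv, hvF⟩ := Set.exists_mem_notMem_of_ncard_lt_ncard (s := (F : Set E)) (t := S)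
      (by rw [Set.ncard_coe_finset]; exact hF.trans_lt hcard)
    exact ⟨v, hv, by simpa using hvF⟩
  obtain ⟨x, ⟨hxΛ, hx⟩, -⟩ := pick ∅ (by simp)
  have normalized (F : Finset E) (hF : F.card ≤ 3) :
      ∃ v ∈ Λ, ⟪v, v⟫_ℝ = m ∧ v ≠ x ∧ ⟪x, v⟫_ℝ = c ∧ ∀ u ∈ F, v ≠ u ∧ v ≠ -u := by
    obtain ⟨v, ⟨hvΛ, hv⟩, hvF⟩ := pick (insert x F ∪ (insert x F).image Neg.neg) <| by
      have h1 := Finset.card_union_le (insert x F) ((insert x F).image Neg.neg)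
      have h2 := Finset.card_image_le (s := insert x F) (f := Neg.neg)
      have h3 := Finset.card_insert_le x F
      omega
    have hvF' : ∀ u ∈ insert x F, v ≠ u ∧ v ≠ -u := by
      refine fun u hu => ⟨?_, ?_⟩ <;> rintro rfl <;> refine hvF (Finset.mem_union.mpr ?_)
      · exact Or.inl hu
      · exact Or.inr (Finset.mem_image_of_mem _ hu)
    obtain ⟨hvx, hvx'⟩ := hvF' x (Finset.mem_insert_self x F)
    rcases eq_or_eq_neg_of_abs_eq (hc x hxΛ v hvΛ hx hv hvx hvx') with h | h
    · exact ⟨v, hvΛ, hv, hvx, h, fun u hu => hvF' u (Finset.mem_insert_of_mem hu)⟩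
    · refine ⟨-v, Λ.neg_mem hvΛ, by simpa using hv, fun h' => hvx' (neg_eq_iff_eq_neg.mp h'),
        by rw [inner_neg_right, h, neg_neg], fun u hu => ?_⟩
      obtain ⟨h1, h2⟩ := hvF' u (Finset.mem_insert_of_mem hu)
      exact ⟨fun h' => h2 (neg_eq_iff_eq_neg.mp h'), fun h' => h1 (neg_injective h')⟩
  obtain ⟨y, hyΛ, hy, hyx, hxy, -⟩ := normalized ∅ (by simp)
  obtain ⟨z, hzΛ, hz, -, hxz, hzF⟩ := normalized {y} (by simp)
  obtain ⟨w, hwΛ, hw, -, hxw, hwF⟩ := normalized {y, z} (Finset.card_le_two.trans (by norm_num))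
  obtain ⟨t, htΛ, ht, -, hxt, htF⟩ := normalized {y, z, w} Finset.card_le_three
  simp only [Finset.mem_insert, Finset.mem_singleton, forall_eq_or_imp, forall_eq] at hzF hwF htF
  obtain ⟨⟨hwy, hwy'⟩, hwz, hwz'⟩ := hwF
  obtain ⟨⟨hty, hty'⟩, ⟨htz, htz'⟩, htw, -⟩ := htF
  have hyz := hc y hyΛ z hzΛ hy hz hzF.1 hzF.2
  have h1 := eq_sub_sub_of_equiangular hdim hm hmin' hxΛ hyΛ hzΛ hwΛ hx hy hz hw hyx.symm hxy hxz
    hxw hyz (hc y hyΛ w hwΛ hy hw hwy hwy') (hc z hzΛ w hwΛ hz hw hwz hwz')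
  have h2 := eq_sub_sub_of_equiangular hdim hm hmin' hxΛ hyΛ hzΛ htΛ hx hy hz ht hyx.symm hxy hxz
    hxt hyz (hc y hyΛ t htΛ hy ht hty hty') (hc z hzΛ t htΛ hz ht htz htz')
  exact htw (h2.trans h1.symm)
end

section
/- Let n be an integer with 24 ≤ n ≤ 41. Then there is no equiangular family of 276 lines in a Euclidean space whose linear span has dimension n; equivalently, there do not exist unit vectors u₁, …, u₂₇₆ spanning an n-dimensional subspace, pairwise non-proportional, such that |⟨u_i, u_j⟩| is a constant α for all i ≠ j. -/
open scoped InnerProductSpace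

/-- A real 3-tensor all of whose contractions equal `c` has squared norm at least `3‖c‖² / (m + 2)`. -/
theorem three_mul_sum_sq_trace_le {κ : Type*} [Fintype κ] (T : κ → κ → κ → ℝ) (c : κ → ℝ)
    (hT₁ : ∀ p, ∑ q, T p q q = c p) (hT₂ : ∀ p, ∑ q, T q p q = c p)
    (hT₃ : ∀ p, ∑ q, T q q p = c p) :
    3 * ∑ p, c p ^ 2 ≤ (Fintype.card κ + 2) * ∑ p, ∑ q, ∑ r, T p q r ^ 2 := by
  classical
  set m : ℝ := (Fintype.card κ : ℝ) with hm
  set U : κ → κ → κ → ℝ := fun p q r =>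
    (if q = r then c p else 0) + (if p = r then c q else 0) + (if p = q then c r else 0) with hU
  have hTU : ∑ p, ∑ q, ∑ r, T p q r * U p q r = 3 * ∑ p, c p ^ 2 := by
    have h₁ : ∑ p, ∑ q, ∑ r, T p q r * (if q = r then c p else 0) = ∑ p, c p ^ 2 := by
      simp only [mul_ite, mul_zero, Finset.sum_ite_eq, Finset.mem_univ, if_true, ← Finset.sum_mul,
        hT₁, sq]
    have h₂ : ∑ p, ∑ q, ∑ r, T p q r * (if p = r then c q else 0) = ∑ p, c p ^ 2 := by
      rw [Finset.sum_comm]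
      simp only [mul_ite, mul_zero, Finset.sum_ite_eq, Finset.mem_univ, if_true, ← Finset.sum_mul,
        hT₂, sq]
    have h₃ : ∑ p, ∑ q, ∑ r, T p q r * (if p = q then c r else 0) = ∑ p, c p ^ 2 := by
      have : ∀ p, ∑ q, ∑ r, T p q r * (if p = q then c r else 0) = ∑ r, T p p r * c r := fun p => by
        rw [Finset.sum_comm]
        simp only [mul_ite, mul_zero, Finset.sum_ite_eq, Finset.mem_univ, if_true]
      simp only [this]
      rw [Finset.sum_comm]
      simp only [← Finset.sum_mul, hT₃, sq]
    simp only [hU, mul_add, Finset.sum_add_distrib, h₁, h₂, h₃]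
    ring
  have hUU : ∑ p, ∑ q, ∑ r, U p q r ^ 2 = 3 * (m + 2) * ∑ p, c p ^ 2 := by
    have e : ∀ p q r, U p q r ^ 2 = (if q = r then c p ^ 2 else 0) + (if p = r then c q ^ 2 else 0)
        + (if p = q then c r ^ 2 else 0)
        + 2 * (if q = r then (if p = r then c p * c q else 0) else 0)
        + 2 * (if q = r then (if p = q then c p * c r else 0) else 0)
        + 2 * (if p = r then (if p = q then c q * c r else 0) else 0) := by
      intro p q r
      simp only [hU]
      split_ifs <;> ring
    simp only [e, Finset.sum_add_distrib, ← Finset.mul_sum]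
    simp [Finset.sum_ite_eq, ← Finset.mul_sum, ← sq]
    ring
  have hpos : 0 ≤ ∑ p, ∑ q, ∑ r, ((m + 2) * T p q r - U p q r) ^ 2 := by positivity
  have hexp : ∑ p, ∑ q, ∑ r, ((m + 2) * T p q r - U p q r) ^ 2 =
      (m + 2) ^ 2 * ∑ p, ∑ q, ∑ r, T p q r ^ 2 - 2 * (m + 2) * ∑ p, ∑ q, ∑ r, T p q r * U p q r
        + ∑ p, ∑ q, ∑ r, U p q r ^ 2 := by
    simp only [Finset.mul_sum, ← Finset.sum_sub_distrib, ← Finset.sum_add_distrib]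
    exact Finset.sum_congr rfl fun p _ => Finset.sum_congr rfl fun q _ =>
      Finset.sum_congr rfl fun r _ => by ring
  rw [hexp, hTU, hUU] at hpos
  have hm2 : (0 : ℝ) < m + 2 := by positivity
  refine le_of_mul_le_mul_left ?_ hm2
  linarith

/-- Positivity of the degree three Gegenbauer kernel, for vectors of arbitrary norm. -/
theorem three_mul_sum_inner_le {ι F : Type*} [Fintype ι] [NormedAddCommGroup F]
    [InnerProductSpace ℝ F] [FiniteDimensional ℝ F] (x : ι → F) :
    3 * ∑ i, ∑ j, ‖x i‖ ^ 2 * ‖x j‖ ^ 2 * ⟪x i, x j⟫_ℝ ≤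
      (Module.finrank ℝ F + 2) * ∑ i, ∑ j, ⟪x i, x j⟫_ℝ ^ 3 := by
  obtain ⟨a, hin⟩ : ∃ a : ι → Fin (Module.finrank ℝ F) → ℝ,
      ∀ i j, ⟪x i, x j⟫_ℝ = ∑ k, a i k * a j k := by
    refine ⟨fun i k => ⟪x i, stdOrthonormalBasis ℝ F k⟫_ℝ, fun i j => ?_⟩
    rw [← (stdOrthonormalBasis ℝ F).sum_inner_mul_inner]
    simp only [real_inner_comm]
  have hn : ∀ i, ‖x i‖ ^ 2 = ∑ k, a i k * a i k := fun i => by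
    rw [← real_inner_self_eq_norm_sq, hin]
  have key := three_mul_sum_sq_trace_le (fun p q r => ∑ i, a i p * a i q * a i r)
    (fun p => ∑ i, ‖x i‖ ^ 2 * a i p) ?_ ?_ ?_
  · rw [Fintype.card_fin] at key
    convert key using 2
    · have : ∀ p, (∑ i, ‖x i‖ ^ 2 * a i p) ^ 2 =
          ∑ i, ∑ j, ‖x i‖ ^ 2 * ‖x j‖ ^ 2 * (a i p * a j p) := by
        intro p
        rw [pow_two, Finset.sum_mul_sum]
        exact Finset.sum_congr rfl fun i _ => Finset.sum_congr rfl fun j _ => by ring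
      simp only [this]
      conv_rhs => rw [Finset.sum_comm]
      refine Finset.sum_congr rfl fun i _ => ?_
      conv_rhs => rw [Finset.sum_comm]
      refine Finset.sum_congr rfl fun j _ => ?_
      rw [hin, Finset.mul_sum]
    · have : ∀ p q r, (∑ i, a i p * a i q * a i r) ^ 2 =
          ∑ i, ∑ j, (a i p * a j p) * ((a i q * a j q) * (a i r * a j r)) := by
        intro p q r
        simp only [sq, Finset.sum_mul_sum]
        exact Finset.sum_congr rfl fun i _ => Finset.sum_congr rfl fun j _ => by ring
      simp only [this, Finset.sum_comm (s := (Finset.univ : Finset (Fin _)))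
        (t := (Finset.univ : Finset ι))]
      refine Finset.sum_congr rfl fun i _ => Finset.sum_congr rfl fun j _ => ?_
      simp only [← Finset.mul_sum, ← Finset.sum_mul, ← hin]
      ring
  all_goals
    intro p
    rw [Finset.sum_comm]
    refine Finset.sum_congr rfl fun i _ => ?_
    rw [hn, Finset.sum_mul]
    all_goals exact Finset.sum_congr rfl fun q _ => by ring

theorem Matrix.rank_add_le_rank_add_rank {m n K : Type*} [Fintype n] [Finite m] [Field K]
    (A B : Matrix m n K) : (A + B).rank ≤ A.rank + B.rank := by
  rw [Matrix.rank, Matrix.mulVecLin_add]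
  exact (Submodule.finrank_mono (LinearMap.range_add_le _ _)).trans
    (Submodule.finrank_add_le_finrank_add_finrank _ _)

/-- For a real symmetric matrix, the squared trace is at most the rank times the squared Frobenius
norm. -/
theorem trace_sq_le_rank_mul {ι : Type*} [Fintype ι] {M : Matrix ι ι ℝ}
    (hM : M.IsHermitian) : M.trace ^ 2 ≤ M.rank * ∑ i, ∑ j, M i j ^ 2 := by
  classical
  have h2 : ∑ i, ∑ j, M i j ^ 2 = ∑ i, hM.eigenvalues i ^ 2 := by
    have : ∑ i, ∑ j, M i j ^ 2 = (M * M).trace := by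
      simp only [Matrix.trace, Matrix.diag, Matrix.mul_apply, sq]
      refine Finset.sum_congr rfl fun i _ => Finset.sum_congr rfl fun j _ => ?_
      congr 1
      simpa using (hM.apply i j).symm
    rw [this]
    conv_lhs => rw [hM.spectral_theorem, ← map_mul, Unitary.conjStarAlgAut_apply, Matrix.trace_mul_cycle]
    simp [Matrix.diagonal_mul_diagonal, Matrix.trace_diagonal, sq]
  have h3 : ∑ i, hM.eigenvalues i =
      ∑ i ∈ Finset.univ.filter (fun i => hM.eigenvalues i ≠ 0), hM.eigenvalues i :=
    (Finset.sum_filter_ne_zero _).symm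
  rw [h2, hM.trace_eq_sum_eigenvalues, hM.rank_eq_card_non_zero_eigs, Fintype.card_subtype]
  simp only [RCLike.ofReal_real_eq_id, id]
  rw [h3]
  refine sq_sum_le_card_mul_sum_sq.trans ?_
  gcongr
  exact Finset.filter_subset _ _

theorem rank_gram_le {ι F : Type*} [Fintype ι] [NormedAddCommGroup F]
    [InnerProductSpace ℝ F] [FiniteDimensional ℝ F] (x : ι → F) :
    (Matrix.gram ℝ x).rank ≤ Module.finrank ℝ F := by
  rw [Matrix.gram_eq_conjTranspose_mul (stdOrthonormalBasis ℝ F)]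
  exact (Matrix.rank_mul_le_right _ _).trans (Matrix.rank_le_card_height _ |>.trans (by simp))

open Polynomial in
theorem minpoly_pow_dvd {K L : Type*} [Field K] [CharZero K] [Field L] [Algebra K L] {x : L}
    (hx : IsIntegral K x) (k : ℕ) {f : K[X]}
    (h : (X - C x) ^ k ∣ f.map (algebraMap K L)) : minpoly K x ^ k ∣ f := by
  induction k generalizing f with
  | zero => simp
  | succ k ih =>
    obtain ⟨g, rfl⟩ : minpoly K x ∣ f := by
      apply minpoly.dvd
      rw [← eval_map_algebraMap]
      exact dvd_iff_isRoot.1 ((dvd_pow_self _ k.succ_ne_zero).trans h)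
    rw [pow_succ']
    refine mul_dvd_mul_left _ (ih ?_)
    have hroot : (X - C x) ∣ (minpoly K x).map (algebraMap K L) := by
      rw [dvd_iff_isRoot, IsRoot, eval_map_algebraMap, minpoly.aeval]
    obtain ⟨r, hr⟩ := hroot
    have hsep : ((minpoly K x).map (algebraMap K L)).Separable :=
      (minpoly.irreducible hx).separable.map
    have hcop : IsCoprime (X - C x) r := by
      rw [hr] at hsep
      exact hsep.isCoprime
    rw [Polynomial.map_mul, hr, pow_succ', mul_assoc,
      mul_dvd_mul_iff_left (X_sub_C_ne_zero x)] at h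
    exact hcop.pow_left.dvd_of_dvd_mul_left h

/-- An eigenvalue of an integer matrix whose multiplicity exceeds half the order is an integer. -/
theorem exists_int_eq_of_two_mul_rank_lt {ι : Type*} [Fintype ι] [DecidableEq ι]
    (S : Matrix ι ι ℤ) (θ : ℝ)
    (h : 2 * (S.map (Int.cast : ℤ → ℝ) + Matrix.diagonal fun _ => θ).rank < Fintype.card ι) :
    ∃ t : ℤ, (t : ℝ) = θ := by
  set A : Matrix ι ι ℝ := S.map (Int.cast : ℤ → ℝ) with hA
  set r := (A + Matrix.diagonal fun _ => θ).rank with hr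
  have hker : Module.finrank ℝ (Module.End.eigenspace A.toLin' (-θ)) = Fintype.card ι - r := by
    have h1 := (A + Matrix.diagonal fun _ => θ).mulVecLin.finrank_range_add_finrank_ker
    rw [Module.finrank_fintype_fun_eq_card] at h1
    have h2 : Module.End.eigenspace A.toLin' (-θ) = LinearMap.ker (A + Matrix.diagonal fun _ => θ).mulVecLin := by
      ext v
      rw [Module.End.mem_eigenspace_iff, LinearMap.mem_ker, Matrix.mulVecLin_apply, Matrix.add_mulVec,
        Matrix.toLin'_apply]
      rw [neg_smul, eq_neg_iff_add_eq_zero, Matrix.diagonal_const_mulVec]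
    rw [h2]
    rw [hr, Matrix.rank]
    omega
  have hmul : Fintype.card ι - r ≤ A.charpoly.rootMultiplicity (-θ) := by
    rw [← hker, ← Matrix.charpoly_toLin']
    exact LinearMap.finrank_eigenspace_le _ _
  have hmapZ : S.charpoly.map (Int.castRingHom ℝ) = A.charpoly := by
    rw [← Matrix.charpoly_map]; rfl
  set f : Polynomial ℚ := S.charpoly.map (Int.castRingHom ℚ) with hf
  have hfmonic : f.Monic := (S.charpoly_monic).map _
  have hmapQ : f.map (algebraMap ℚ ℝ) = A.charpoly := by
    rw [hf, Polynomial.map_map, ← hmapZ]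
    congr 1
  have hpos : 0 < Fintype.card ι - r := by omega
  have hroot : A.charpoly.IsRoot (-θ) :=
    (Polynomial.rootMultiplicity_pos (A.charpoly_monic.ne_zero)).1 (hpos.trans_le hmul)
  have hintZ : IsIntegral ℤ (-θ) := by
    refine ⟨S.charpoly, S.charpoly_monic, ?_⟩
    rw [← hmapZ, Polynomial.IsRoot, Polynomial.eval_map] at hroot
    exact hroot
  have hintQ : IsIntegral ℚ (-θ) := hintZ.tower_top
  have hdvd : minpoly ℚ (-θ) ^ (Fintype.card ι - r) ∣ f := by
    refine minpoly_pow_dvd hintQ _ ?_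
    rw [hmapQ]
    exact (pow_dvd_pow _ hmul).trans (Polynomial.pow_rootMultiplicity_dvd _ _)
  have hdeg := Polynomial.natDegree_le_of_dvd hdvd hfmonic.ne_zero
  rw [Polynomial.natDegree_pow, hf, S.charpoly_monic.natDegree_map, Matrix.charpoly_natDegree_eq_dim] at hdeg
  have hd : (minpoly ℚ (-θ)).natDegree = 1 := by
    have h1 := minpoly.natDegree_pos hintQ
    by_contra hne
    have : 2 ≤ (minpoly ℚ (-θ)).natDegree := by omega
    have := Nat.mul_le_mul_left (Fintype.card ι - r) this
    omega
  obtain ⟨q, hq⟩ := minpoly.natDegree_eq_one_iff.1 hd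
  rw [← hq, isIntegral_algebraMap_iff (algebraMap ℚ ℝ).injective] at hintZ
  obtain ⟨z, hz⟩ := IsIntegrallyClosed.isIntegral_iff.1 hintZ
  refine ⟨-z, ?_⟩
  rw [← neg_eq_iff_eq_neg] at hq
  rw [← hq, ← hz]
  simp

/-- An integer eigenvalue of a Seidel matrix of even order is odd. -/
theorem odd_of_rank_lt {ι : Type*} [Fintype ι] [DecidableEq ι] (S : Matrix ι ι ℤ) (t : ℤ)
    (hι : Even (Fintype.card ι)) (hd : ∀ i, S i i = 0) (ho : ∀ i j, i ≠ j → Odd (S i j))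
    (h : (S.map (Int.cast : ℤ → ℝ) + Matrix.diagonal fun _ => (t : ℝ)).rank < Fintype.card ι) :
    Odd t := by
  rw [← Int.not_even_iff_odd]
  intro ht
  set M : Matrix ι ι ℤ := S + Matrix.diagonal fun _ => t with hM
  have hdet : M.det = 0 := by
    by_contra hne
    have hmap : S.map (Int.cast : ℤ → ℝ) + (Matrix.diagonal fun _ => (t : ℝ)) =
        (Int.castRingHom ℝ).mapMatrix M := by
      ext i j
      by_cases hij : i = j <;> simp [hM, hij]
    rw [hmap, Matrix.rank_of_isUnit] at h
    · exact lt_irrefl _ h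
    · rw [Matrix.isUnit_iff_isUnit_det, ← RingHom.map_det, isUnit_iff_ne_zero]
      simpa using hne
  have h2 : (Int.castRingHom (ZMod 2)).mapMatrix M = Matrix.of (fun _ _ => 1) - 1 := by
    ext i j
    by_cases hij : i = j
    · subst hij
      simpa [hM, hd] using (ZMod.intCast_zmod_eq_zero_iff_dvd t 2).2 ht.two_dvd
    · obtain ⟨k, hk⟩ := ho i j hij
      have : (2 : ZMod 2) = 0 := rfl
      simp [hM, hij, hk, this]
  have hsq : (Matrix.of (fun _ _ => 1) - 1 : Matrix ι ι (ZMod 2)) * (Matrix.of (fun _ _ => 1) - 1) = 1 := by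
    have hJ : (Matrix.of (fun _ _ => 1) : Matrix ι ι (ZMod 2)) * Matrix.of (fun _ _ => 1) = 0 := by
      ext i j
      simpa [Matrix.mul_apply] using (ZMod.natCast_eq_zero_iff_even).2 hι
    rw [sub_mul, mul_sub, mul_sub, hJ]
    ext i j
    simp
  have hd2 := congrArg Matrix.det hsq
  rw [Matrix.det_mul, ← h2, ← RingHom.map_det, hdet] at hd2
  simp at hd2

/-- The degree three Gegenbauer inequality for the projections to `uᗮ` of unit vectors `x i` that make
the same angle with `u` and are equiangular. -/
theorem cone_cubic_bound {V : Type*} [NormedAddCommGroup V] [InnerProductSpace ℝ V]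
    [FiniteDimensional ℝ V]
    {κ : Type*} [Fintype κ] {x : κ → V} {u : V} {α : ℝ}
    (hu : ‖u‖ = 1) (hx : ∀ i, ‖x i‖ = 1) (hxu : ∀ i, ⟪x i, u⟫_ℝ = α)
    (hxx : ∀ i j, i ≠ j → ⟪x i, x j⟫_ℝ ^ 2 = α ^ 2) :
    3 * (1 - α ^ 2) ^ 2 *
        (∑ i, ∑ j, ⟪x i, x j⟫_ℝ - (Fintype.card κ : ℝ) ^ 2 * α ^ 2) ≤
      (Module.finrank ℝ V + 1) * ((α ^ 2 + 3 * α ^ 4) * ∑ i, ∑ j, ⟪x i, x j⟫_ℝ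
        - (Fintype.card κ : ℝ) ^ 2 * (3 * α ^ 4 + α ^ 6)
        + Fintype.card κ * ((1 - α ^ 2) * (1 - 3 * α ^ 2))) := by
  classical
  have hu0 : u ≠ 0 := by rintro rfl; simp at hu
  have huu : ⟪u, u⟫_ℝ = 1 := by rw [real_inner_self_eq_norm_sq, hu]; norm_num
  let y : κ → (ℝ ∙ u)ᗮ := fun i => ⟨x i - α • u, by
    rw [Submodule.mem_orthogonal_singleton_iff_inner_left, inner_sub_left, inner_smul_left, hxu, huu]
    simp⟩
  have hy : ∀ i j, ⟪y i, y j⟫_ℝ = ⟪x i, x j⟫_ℝ - α ^ 2 := fun i j => by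
    simp only [y, Submodule.coe_inner, inner_sub_left, inner_sub_right, inner_smul_left,
      inner_smul_right, hxu, huu, real_inner_comm (x j) u]
    simp
    ring
  have hyn : ∀ i, ‖y i‖ ^ 2 = 1 - α ^ 2 := fun i => by
    rw [← real_inner_self_eq_norm_sq, hy, real_inner_self_eq_norm_sq, hx]; norm_num
  have hfin : (Module.finrank ℝ V : ℝ) = Module.finrank ℝ (ℝ ∙ u)ᗮ + 1 := by
    have := (ℝ ∙ u).finrank_add_finrank_orthogonal
    rw [finrank_span_singleton hu0] at this
    rw [← this]; push_cast; ring
  have hcube : ∀ i j, ⟪y i, y j⟫_ℝ ^ 3 = (α ^ 2 + 3 * α ^ 4) * ⟪x i, x j⟫_ℝ - (3 * α ^ 4 + α ^ 6)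
      + if i = j then (1 - α ^ 2) * (1 - 3 * α ^ 2) else 0 := fun i j => by
    rw [hy]
    split_ifs with hij
    · subst hij
      rw [real_inner_self_eq_norm_sq, hx]; ring
    · have := hxx i j hij
      generalize ⟪x i, x j⟫_ℝ = g at *
      linear_combination (g - 3 * α ^ 2) * this
  have key := three_mul_sum_inner_le y
  simp only [hcube, hyn] at key
  simp only [hy, Finset.sum_add_distrib, Finset.sum_sub_distrib, ← Finset.mul_sum,
    Finset.sum_ite_eq, Finset.mem_univ, if_true, Finset.sum_const, Finset.card_univ,
    nsmul_eq_mul] at key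
  rw [hfin]
  linarith

/-- The trace-rank inequality for a Gram matrix shifted by a constant matrix. -/
theorem card_mul_sub_sq_le {V : Type*} [NormedAddCommGroup V] [InnerProductSpace ℝ V]
    [FiniteDimensional ℝ V]
    {κ : Type*} [Fintype κ] {x : κ → V} (hx : ∀ i, ‖x i‖ = 1) (t : ℝ) :
    (Fintype.card κ * (1 - t)) ^ 2 ≤
      (Module.finrank ℝ V + 1) * ∑ i, ∑ j, (⟪x i, x j⟫_ℝ - t) ^ 2 := by
  set M : Matrix κ κ ℝ := Matrix.gram ℝ x + Matrix.vecMulVec (fun _ => -t) (fun _ => 1) with hM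
  have hMij : ∀ i j, M i j = ⟪x i, x j⟫_ℝ - t := fun i j => by
    simp [hM, Matrix.gram_apply, Matrix.vecMulVec_apply, sub_eq_add_neg]
  have hherm : M.IsHermitian := by
    ext i j
    simp only [Matrix.conjTranspose_apply, hMij, real_inner_comm, star_trivial]
  have hrank : M.rank ≤ Module.finrank ℝ V + 1 :=
    (Matrix.rank_add_le_rank_add_rank _ _).trans
      (add_le_add (rank_gram_le x) (Matrix.rank_vecMulVec_le _ _))
  have htr : M.trace = Fintype.card κ * (1 - t) := by
    simp [Matrix.trace, hMij, hx, mul_sub]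
  rw [← htr]
  refine (trace_sq_le_rank_mul hherm).trans ?_
  simp only [hMij]
  gcongr
  exact_mod_cast hrank

theorem card_sq_le {V : Type*} [NormedAddCommGroup V] [InnerProductSpace ℝ V]
    [FiniteDimensional ℝ V]
    {κ : Type*} [Fintype κ] {x : κ → V} (hx : ∀ i, ‖x i‖ = 1) :
    (Fintype.card κ : ℝ) ^ 2 ≤ Module.finrank ℝ V * ∑ i, ∑ j, ⟪x i, x j⟫_ℝ ^ 2 := by
  have h := trace_sq_le_rank_mul (Matrix.isHermitian_gram ℝ x)
  have htr : (Matrix.gram ℝ x).trace = Fintype.card κ := by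
    simp [Matrix.trace, Matrix.gram_apply, hx]
  rw [htr] at h
  simp only [Matrix.gram_apply] at h
  refine h.trans ?_
  gcongr
  exact rank_gram_le x

/-- The lines other than the `i`-th one can be spanned by unit vectors having inner product `α` with
`u i`. -/
theorem exists_switching {V : Type*} [NormedAddCommGroup V] [InnerProductSpace ℝ V]
    {ι : Type*} [Fintype ι] [DecidableEq ι] {u : ι → V} {α : ℝ} (hα : 0 < α)
    (hu : ∀ i, ‖u i‖ = 1) (huu : ∀ i j, i ≠ j → |⟪u i, u j⟫_ℝ| = α) (i : ι) :
    ∃ x : {j // j ≠ i} → V, (∀ j, ‖x j‖ = 1) ∧ (∀ j, ⟪x j, u i⟫_ℝ = α) ∧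
      (∀ j k, j ≠ k → ⟪x j, x k⟫_ℝ ^ 2 = α ^ 2) ∧
      ∑ j, ⟪u j, u i⟫_ℝ • u j = u i + α • ∑ j, x j := by
  have hs : ∀ j, j ≠ i → (⟪u j, u i⟫_ℝ / α) ^ 2 = 1 := fun j hj => by
    rw [div_pow, ← sq_abs, huu j i hj, div_self (by positivity)]
  refine ⟨fun j => (⟪u j, u i⟫_ℝ / α) • u j, fun j => ?_, fun j => ?_, fun j k hjk => ?_, ?_⟩
  · rw [norm_smul, hu, mul_one, Real.norm_eq_abs, ← sq_eq_sq₀ (abs_nonneg _) zero_le_one, sq_abs,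
      one_pow]
    exact hs j j.2
  · rw [real_inner_smul_left]
    have := hs j j.2
    field_simp at this ⊢
    exact this
  · rw [real_inner_smul_left, real_inner_smul_right, mul_pow, mul_pow, hs j j.2, hs k k.2,
      ← sq_abs ⟪u j, u k⟫_ℝ, huu _ _ (Subtype.coe_injective.ne hjk)]
    ring
  · rw [← Finset.add_sum_erase _ _ (Finset.mem_univ i), Finset.smul_sum]
    congr 1
    · rw [real_inner_self_eq_norm_sq, hu]; simp
    · rw [Finset.sum_subtype (Finset.univ.erase i) (p := fun j => j ≠ i) (by simp)]
      refine Finset.sum_congr rfl fun j _ => ?_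
      rw [smul_smul, mul_div_cancel₀ _ hα.ne']

/-- At cosine `1 / 5` the degree one and degree three inequalities are both tight, so that the lines
form a tight frame for their span. -/
theorem sum_inner_smul_eq_twelve_smul {V : Type*} [NormedAddCommGroup V] [InnerProductSpace ℝ V]
    [FiniteDimensional ℝ V] {u : Fin 276 → V} (hn : Module.finrank ℝ V ≤ 41)
    (hu : ∀ i, ‖u i‖ = 1) (huu : ∀ i j, i ≠ j → |⟪u i, u j⟫_ℝ| = 1 / 5) (i : Fin 276) :
    ∑ j, ⟪u j, u i⟫_ℝ • u j = (12 : ℝ) • u i := by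
  obtain ⟨x, hx, hxu, hxx, hsum⟩ := exists_switching (by norm_num) hu huu i
  have hcard : Fintype.card {j : Fin 276 // j ≠ i} = 275 := by simp
  have hcub := cone_cubic_bound (hu i) hx hxu hxx
  rw [hcard] at hcub
  have huu1 : ⟪u i, u i⟫_ℝ = 1 := by rw [real_inner_self_eq_norm_sq, hu]; norm_num
  have hxuS : ⟪∑ j, x j, u i⟫_ℝ = 55 := by
    rw [sum_inner]
    simp only [hxu, Finset.sum_const, Finset.card_univ, hcard]
    norm_num
  have hxxS : ⟪∑ j, x j, ∑ j, x j⟫_ℝ = ∑ j, ∑ k, ⟪x j, x k⟫_ℝ := by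
    simp only [sum_inner, inner_sum]
    exact Finset.sum_comm
  have hnorm : ‖∑ j, x j - (55 : ℝ) • u i‖ ^ 2 = ∑ j, ∑ k, ⟪x j, x k⟫_ℝ - 55 ^ 2 := by
    rw [← real_inner_self_eq_norm_sq, inner_sub_left, inner_sub_right, inner_sub_right,
      real_inner_smul_left, real_inner_smul_left, real_inner_smul_right, real_inner_smul_right,
      real_inner_comm (∑ j, x j) (u i), hxuS, hxxS, huu1]
    ring
  have hzero : ∑ j, x j - (55 : ℝ) • u i = 0 := by
    rw [← norm_eq_zero, ← sq_eq_zero_iff]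
    refine le_antisymm ?_ (sq_nonneg _)
    have h0 := sq_nonneg ‖∑ j, x j - (55 : ℝ) • u i‖
    rw [hnorm] at h0 ⊢
    generalize ∑ j, ∑ k, ⟪x j, x k⟫_ℝ = G at *
    generalize Module.finrank ℝ V = n at *
    interval_cases n <;> norm_num at hcub <;> linarith
  rw [hsum, sub_eq_zero.1 hzero, smul_smul]
  nth_rewrite 1 [← one_smul ℝ (u i)]
  rw [← add_smul]
  norm_num

theorem finrank_gt_of_cosine_one_third {V : Type*} [NormedAddCommGroup V]
    [InnerProductSpace ℝ V] [FiniteDimensional ℝ V] {u : Fin 276 → V}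
    (h24 : 24 ≤ Module.finrank ℝ V) (hu : ∀ i, ‖u i‖ = 1)
    (huu : ∀ i j, i ≠ j → |⟪u i, u j⟫_ℝ| = 1 / 3) :
    41 < Module.finrank ℝ V := by
  by_contra! hn
  obtain ⟨x, hx, hxu, hxx, -⟩ := exists_switching (by norm_num) hu huu 0
  have hcard : Fintype.card {j : Fin 276 // j ≠ 0} = 275 := by simp
  have hcub := cone_cubic_bound (hu 0) hx hxu hxx
  have hrk := card_mul_sub_sq_le hx (1 / 3)
  have hsq : ∀ i j, (⟪x i, x j⟫_ℝ - 1 / 3) ^ 2 =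
      2 / 9 - 2 / 3 * ⟪x i, x j⟫_ℝ + if i = j then 8 / 9 else 0 := fun i j => by
    split_ifs with hij
    · subst hij
      rw [real_inner_self_eq_norm_sq, hx]; norm_num
    · linear_combination hxx i j hij
  simp only [hsq, Finset.sum_add_distrib, Finset.sum_sub_distrib, ← Finset.mul_sum,
    Finset.sum_ite_eq, Finset.mem_univ, if_true, Finset.sum_const, Finset.card_univ,
    nsmul_eq_mul] at hrk
  rw [hcard] at hcub hrk
  generalize ∑ j, ∑ k, ⟪x j, x k⟫_ℝ = G at *
  generalize Module.finrank ℝ V = n at *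
  interval_cases n <;> norm_num at hcub hrk <;> linarith

/-- Neumann's theorem: more than `2n` equiangular lines in dimension `n` have the inverse of an odd
integer as common cosine. -/
theorem inv_odd_of_two_mul_finrank_lt {V ι : Type*} [NormedAddCommGroup V]
    [InnerProductSpace ℝ V] [FiniteDimensional ℝ V] [Fintype ι] {u : ι → V} {α : ℝ} (hα : 0 < α)
    (hu : ∀ i, ‖u i‖ = 1) (huu : ∀ i j, i ≠ j → |⟪u i, u j⟫_ℝ| = α)
    (hι : Even (Fintype.card ι)) (h : 2 * Module.finrank ℝ V < Fintype.card ι) :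
    ∃ t : ℤ, Odd t ∧ (t : ℝ) = α⁻¹ := by
  classical
  let S : Matrix ι ι ℤ :=
    Matrix.of fun i j => if i = j then 0 else if 0 ≤ ⟪u i, u j⟫_ℝ then 1 else -1
  have hS : S.map (Int.cast : ℤ → ℝ) + (Matrix.diagonal fun _ => α⁻¹) =
      Matrix.gram ℝ u * (Matrix.diagonal fun _ => α⁻¹) := by
    ext i j
    rw [Matrix.mul_diagonal, Matrix.gram_apply]
    by_cases hij : i = j
    · subst hij
      simp [S, hu]
    · have habs := huu i j hij
      by_cases h0 : 0 ≤ ⟪u i, u j⟫_ℝ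
      · rw [abs_of_nonneg h0] at habs
        simp [S, hij, habs, hα.le, hα.ne']
      · rw [abs_of_neg (not_le.1 h0), neg_eq_iff_eq_neg] at habs
        simp [S, hij, habs, hα, hα.ne']
  have hrank : (S.map (Int.cast : ℤ → ℝ) + (Matrix.diagonal fun _ => α⁻¹)).rank ≤
      Module.finrank ℝ V := by
    rw [hS]
    exact (Matrix.rank_mul_le_left _ _).trans (rank_gram_le u)
  obtain ⟨t, ht⟩ := exists_int_eq_of_two_mul_rank_lt S α⁻¹ (by omega)
  refine ⟨t, odd_of_rank_lt S t hι (fun i => by simp [S]) (fun i j hij => ?_) ?_, ht⟩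
  · simp only [S, Matrix.of_apply, hij, if_false]
    split_ifs <;> decide
  · rw [ht]
    omega

theorem one_seventh_lt_of_finrank_le {V : Type*} [NormedAddCommGroup V] [InnerProductSpace ℝ V]
    [FiniteDimensional ℝ V] {u : Fin 276 → V} {α : ℝ} (hn : Module.finrank ℝ V ≤ 41)
    (hα : 0 ≤ α) (hu : ∀ i, ‖u i‖ = 1) (huu : ∀ i j, i ≠ j → |⟪u i, u j⟫_ℝ| = α) :
    1 / 7 < α := by
  have h := card_sq_le hu
  have hsq : ∀ i j, ⟪u i, u j⟫_ℝ ^ 2 = α ^ 2 + if i = j then 1 - α ^ 2 else 0 := fun i j => by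
    split_ifs with hij
    · subst hij
      rw [real_inner_self_eq_norm_sq, hu]; norm_num
    · rw [← sq_abs, huu i j hij, add_zero]
  simp only [hsq, Finset.sum_add_distrib, Finset.sum_ite_eq, Finset.mem_univ, if_true,
    Finset.sum_const, Finset.card_univ, nsmul_eq_mul, Fintype.card_fin] at h
  have hn' : (Module.finrank ℝ V : ℝ) ≤ 41 := by exact_mod_cast hn
  have h2 : (276 : ℝ) ^ 2 ≤ 41 * (276 * (276 * α ^ 2) + 276 * (1 - α ^ 2)) := by
    refine le_trans (by exact_mod_cast h) (mul_le_mul_of_nonneg_right hn' ?_)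
    nlinarith [sq_nonneg α]
  nlinarith

theorem finrank_eq_of_sum_inner_smul {V : Type*} [NormedAddCommGroup V] [InnerProductSpace ℝ V]
    [FiniteDimensional ℝ V] {ι : Type*} [Fintype ι] {u : ι → V} {c : ℝ} (hu : ∀ i, ‖u i‖ = 1)
    (h : ∀ x, ∑ j, ⟪u j, x⟫_ℝ • u j = c • x) :
    (Fintype.card ι : ℝ) = c * Module.finrank ℝ V := by
  let b := stdOrthonormalBasis ℝ V
  calc (Fintype.card ι : ℝ) = ∑ j, ∑ k, ‖⟪u j, b k⟫_ℝ‖ ^ 2 := by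
        simp only [b.sum_sq_norm_inner_left, hu]
        simp
    _ = ∑ k, ⟪∑ j, ⟪u j, b k⟫_ℝ • u j, b k⟫_ℝ := by
        rw [Finset.sum_comm]
        simp [sum_inner, real_inner_smul_left, sq]
    _ = c * Module.finrank ℝ V := by
        simp [h, real_inner_smul_left, mul_comm]

/-- Proposition 3.3. For `24 ≤ n ≤ 41` there is no equiangular
family of `276` lines spanning an `n`-dimensional subspace of a Euclidean space:
there are no unit vectors `u₁, …, u₂₇₆`, pairwise non-proportional, whose pairwise
inner products have constant absolute value and whose span has dimension `n`. -/
theorem no_276_equiangular_lines_rank_24_to_41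
    {E : Type*} [NormedAddCommGroup E] [InnerProductSpace ℝ E] [FiniteDimensional ℝ E]
    (n : ℕ) (h24 : 24 ≤ n) (h41 : n ≤ 41) :
    ¬ ∃ (u : Fin 276 → E) (α : ℝ),
        (∀ i, ‖u i‖ = 1) ∧
        (∀ i j, i ≠ j → u i ≠ u j ∧ u i ≠ -u j) ∧
        (∀ i j, i ≠ j → |⟪u i, u j⟫_ℝ| = α) ∧
        Module.finrank ℝ (Submodule.span ℝ (Set.range u)) = n := by
  rintro ⟨u, α, hu, hne, huu, hn⟩
  let v : Fin 276 → Submodule.span ℝ (Set.range u) :=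
    fun i => ⟨u i, Submodule.subset_span (Set.mem_range_self i)⟩
  have hv : ∀ i, ‖v i‖ = 1 := hu
  have hvv : ∀ i j, i ≠ j → |⟪v i, v j⟫_ℝ| = α := huu
  have hα0 : 0 ≤ α := by
    rw [← huu 0 1 (by decide)]
    exact abs_nonneg _
  have hα7 := one_seventh_lt_of_finrank_le (hn.trans_le h41) hα0 hv hvv
  have hα1 : α ≠ 1 := by
    rintro rfl
    have h01 := huu 0 1 (by decide)
    rcases eq_or_eq_neg_of_abs_eq h01 with h | h
    · exact (hne 0 1 (by decide)).1 ((inner_eq_one_iff_of_norm_eq_one (hu 0) (hu 1)).1 h)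
    · refine (hne 0 1 (by decide)).2
        ((inner_eq_one_iff_of_norm_eq_one (𝕜 := ℝ) (hu 0) (by rw [norm_neg, hu])).1 ?_)
      rw [inner_neg_right, h, neg_neg]
  have hα : 0 < α := by linarith
  obtain ⟨t, htodd, ht⟩ := inv_odd_of_two_mul_finrank_lt hα hv hvv (by simp; decide)
    (by rw [hn, Fintype.card_fin]; omega)
  have ht0 : 0 < t := by
    have : (0 : ℝ) < t := by rw [ht]; positivity
    exact_mod_cast this
  have ht7 : t < 7 := by
    have : (t : ℝ) < 7 := by
      rw [ht]
      exact inv_lt_of_inv_lt₀ (by norm_num) (by linarith)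
    exact_mod_cast this
  have hαt : α = (t : ℝ)⁻¹ := by rw [ht, inv_inv]
  obtain rfl | rfl | rfl : t = 1 ∨ t = 3 ∨ t = 5 := by
    obtain ⟨k, rfl⟩ := htodd
    omega
  · exact hα1 (by simpa using hαt)
  · have := finrank_gt_of_cosine_one_third (h24.trans_eq hn.symm) hv (by simpa [hαt] using hvv)
    omega
  · have hframe := sum_inner_smul_eq_twelve_smul (hn.trans_le h41) hv
      (by simpa [hαt] using hvv)
    have hspan : Submodule.span ℝ (Set.range v) = ⊤ :=
      (Submodule.span_range_subtype_eq_top_iff _ _).2 rfl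
    have hall : ∀ x, ∑ j, ⟪v j, x⟫_ℝ • v j = (12 : ℝ) • x := fun x => by
      have hx : x ∈ Submodule.span ℝ (Set.range v) := hspan ▸ Submodule.mem_top
      induction hx using Submodule.span_induction with
      | mem x hx =>
        obtain ⟨i, rfl⟩ := hx
        exact hframe i
      | zero => simp
      | add x y _ _ hx hy =>
        simp only [inner_add_right, add_smul, Finset.sum_add_distrib, hx, hy, smul_add]
      | smul a x _ hx =>
        simp only [real_inner_smul_right, mul_smul, ← Finset.smul_sum, hx]
        rw [smul_comm]
    have h12 := finrank_eq_of_sum_inner_smul hv hall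
    rw [hn, Fintype.card_fin] at h12
    have : 276 = 12 * n := by exact_mod_cast h12
    omega
end
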